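/- arXiv:2605.16140 — 3 statements merged into one kernel-verified Lean document; each statement's English description precedes it below -/
import Mathlib

section
/- Let (Ω, 𝔽, P) be a probability space, let τ and Γ be ℕ-valued random variables, let (β_i)_{i∈ℕ} be a sequence of random variables with values in [0,1], and let χ₀ ≥ 0, χ₁ > 0, δ ≥ 0. Suppose E[ Σ_{i=1}^{τ} (χ₀·𝟙{i ≤ Γ} + χ₁·𝟙{i > Γ})·β_i² ] ≤ δ. Then E[ Σ_{i=Γ+1}^{τ} β_i ] ≤ √( (δ/χ₁) · E[(τ − Γ)⁺] ), where (x)⁺ = max{x, 0} and the sum Σ_{i=Γ+1}^{τ} is understood to be 0 when τ ≤ Γ. -/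
open MeasureTheory Finset

/-- Pathwise Young-type bound: for every real `t`, the post-change effort is controlled by the
covertness budget and the detection delay. -/
theorem two_mul_sum_le_budget_add_delay (b : ℕ → ℝ) (m n : ℕ) {χ₀ χ₁ : ℝ} (hχ₀ : 0 ≤ χ₀)
    (hχ₁ : 0 < χ₁) (t : ℝ) :
    2 * t * ∑ i ∈ Finset.Icc (m + 1) n, b i ≤
      t ^ 2 / χ₁ * (∑ i ∈ Finset.Icc 1 n,
        (χ₀ * (if i ≤ m then (1 : ℝ) else 0) + χ₁ * (if m < i then (1 : ℝ) else 0)) * b i ^ 2)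
        + ((n - m : ℕ) : ℝ) := by
  have hdrop : χ₁ * ∑ i ∈ Finset.Icc (m + 1) n, b i ^ 2 ≤ ∑ i ∈ Finset.Icc 1 n,
      (χ₀ * (if i ≤ m then (1 : ℝ) else 0) + χ₁ * (if m < i then (1 : ℝ) else 0)) * b i ^ 2 := by
    calc χ₁ * ∑ i ∈ Finset.Icc (m + 1) n, b i ^ 2
        = ∑ i ∈ Finset.Icc (m + 1) n, (χ₀ * (if i ≤ m then (1 : ℝ) else 0)
            + χ₁ * (if m < i then (1 : ℝ) else 0)) * b i ^ 2 := by
          rw [Finset.mul_sum]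
          refine Finset.sum_congr rfl fun i hi => ?_
          have hmi : m < i := (Finset.mem_Icc.1 hi).1
          simp [hmi, not_le.2 hmi]
      _ ≤ _ := by
          refine Finset.sum_le_sum_of_subset_of_nonneg
            (Finset.Icc_subset_Icc (by omega) le_rfl) fun i _ _ => ?_
          split_ifs <;> positivity
  calc 2 * t * ∑ i ∈ Finset.Icc (m + 1) n, b i
      ≤ ∑ i ∈ Finset.Icc (m + 1) n, (t ^ 2 * b i ^ 2 + 1) := by
        rw [Finset.mul_sum]
        exact Finset.sum_le_sum fun i _ => by nlinarith [sq_nonneg (t * b i - 1)]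
    _ = t ^ 2 / χ₁ * (χ₁ * ∑ i ∈ Finset.Icc (m + 1) n, b i ^ 2) + ((n - m : ℕ) : ℝ) := by
        rw [Finset.sum_add_distrib, ← Finset.mul_sum]
        simp only [Finset.sum_const, Nat.card_Icc, Nat.add_sub_add_right, nsmul_eq_mul, mul_one]
        field_simp
    _ ≤ _ := by gcongr

/-- **Covertness bottleneck lemma.**
If the expected covertness budget
`E[ Σ_{i=1}^{τ} (χ₀·𝟙{i ≤ Γ} + χ₁·𝟙{i > Γ})·β_i² ] ≤ δ`, then the expected
post-change sensing effort satisfies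
`E[ Σ_{i=Γ+1}^{τ} β_i ] ≤ √( (δ/χ₁) · E[(τ − Γ)⁺] )`. -/
theorem stmt_3 {Ω : Type*} [MeasurableSpace Ω] (P : Measure Ω) [IsProbabilityMeasure P]
    (τ Γ : Ω → ℕ) (hτ : Measurable τ) (hΓ : Measurable Γ)
    (β : ℕ → Ω → ℝ) (hβmeas : ∀ i, Measurable (β i))
    (hβ : ∀ i ω, β i ω ∈ Set.Icc (0 : ℝ) 1)
    (χ₀ χ₁ δ : ℝ) (hχ₀ : 0 ≤ χ₀) (hχ₁ : 0 < χ₁) (hδ : 0 ≤ δ)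
    (hECBint : Integrable (fun ω =>
      ∑ i ∈ Finset.Icc 1 (τ ω),
        (χ₀ * (if i ≤ Γ ω then (1 : ℝ) else 0) + χ₁ * (if Γ ω < i then (1 : ℝ) else 0))
          * (β i ω) ^ 2) P)
    (hADDint : Integrable (fun ω => ((τ ω - Γ ω : ℕ) : ℝ)) P)
    (hECB : (∫ ω, ∑ i ∈ Finset.Icc 1 (τ ω),
        (χ₀ * (if i ≤ Γ ω then (1 : ℝ) else 0) + χ₁ * (if Γ ω < i then (1 : ℝ) else 0))
          * (β i ω) ^ 2 ∂P) ≤ δ) :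
    (∫ ω, ∑ i ∈ Finset.Icc (Γ ω + 1) (τ ω), β i ω ∂P)
      ≤ Real.sqrt ((δ / χ₁) * ∫ ω, ((τ ω - Γ ω : ℕ) : ℝ) ∂P) := by
  have hS : ∀ ω, 0 ≤ ∑ i ∈ Finset.Icc (Γ ω + 1) (τ ω), β i ω :=
    fun ω => Finset.sum_nonneg fun i _ => (hβ i ω).1
  have hB : 0 ≤ ∫ ω, ∑ i ∈ Finset.Icc (Γ ω + 1) (τ ω), β i ω ∂P := integral_nonneg hS
  have hd : 0 ≤ ∫ ω, ((τ ω - Γ ω : ℕ) : ℝ) ∂P := integral_nonneg fun ω => Nat.cast_nonneg _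
  have hquad : ∀ t : ℝ, 2 * t * (∫ ω, ∑ i ∈ Finset.Icc (Γ ω + 1) (τ ω), β i ω ∂P) ≤
      t ^ 2 * (δ / χ₁) + ∫ ω, ((τ ω - Γ ω : ℕ) : ℝ) ∂P := by
    intro t
    rcases le_total t 0 with ht | ht
    · have hleft := mul_nonpos_of_nonpos_of_nonneg (by linarith : 2 * t ≤ 0) hB
      have hright : 0 ≤ t ^ 2 * (δ / χ₁) := by positivity
      linarith
    · have hmono := integral_mono_of_nonneg
        (Filter.Eventually.of_forall fun ω => mul_nonneg (by linarith : 0 ≤ 2 * t) (hS ω))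
        ((hECBint.const_mul (t ^ 2 / χ₁)).add hADDint)
        (Filter.Eventually.of_forall fun ω =>
          two_mul_sum_le_budget_add_delay (fun i => β i ω) (Γ ω) (τ ω) hχ₀ hχ₁ t)
      rw [integral_add' (hECBint.const_mul _) hADDint, integral_const_mul,
        integral_const_mul] at hmono
      have hbudget := mul_le_mul_of_nonneg_left hECB (by positivity : 0 ≤ t ^ 2 / χ₁)
      have heq : t ^ 2 / χ₁ * δ = t ^ 2 * (δ / χ₁) := by ring
      linarith
  have hdiscrim := discrim_le_zero (a := δ / χ₁)
    (b := -2 * ∫ ω, ∑ i ∈ Finset.Icc (Γ ω + 1) (τ ω), β i ω ∂P)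
    (c := ∫ ω, ((τ ω - Γ ω : ℕ) : ℝ) ∂P) fun t => by linarith [hquad t]
  rw [discrim] at hdiscrim
  exact Real.le_sqrt_of_sq_le (by linarith)
end

section
/- Let Z be a finite nonempty set, let Q₀ and Q₁ be probability mass functions on Z such that Q₀(z) = 0 implies Q₁(z) = 0, and let β ∈ [0,1]. Define the mixture P_β(z) = (1−β)·Q₀(z) + β·Q₁(z). Then D(P_β ‖ Q₀) ≤ β² · χ₂(Q₁‖Q₀), where D(P‖Q) = Σ_z P(z)·ln(P(z)/Q(z)) is the relative entropy (with the convention 0·ln 0 = 0) and χ₂(Q₁‖Q₀) = Σ_{z : Q₀(z)>0} (Q₁(z) − Q₀(z))²/Q₀(z) is the χ²-divergence. -/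
open Finset Classical

/-- Pointwise form of the bound of relative entropy by the `χ²`-divergence. -/
theorem mul_log_div_le_sub_add_sq_div {p q : ℝ} (hp : 0 ≤ p) (hq : 0 ≤ q) (hpq : q = 0 → p = 0) :
    p * Real.log (p / q) ≤ (p - q) + (p - q) ^ 2 / q := by
  rcases hq.eq_or_lt with rfl | hq
  · simp [hpq rfl]
  rcases hp.eq_or_lt with rfl | hp
  · apply le_of_eq
    field_simp
    simp
  calc p * Real.log (p / q) ≤ p * (p / q - 1) := by
        gcongr
        exact Real.log_le_sub_one_of_pos (div_pos hp hq)
    _ = (p - q) + (p - q) ^ 2 / q := by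
        field_simp
        ring

/-- **Per-time-step covertness bound.**
For probability mass functions `Q₀, Q₁` on a finite set with `Q₁ ≪ Q₀` and
`β ∈ [0,1]`, the mixture `P_β = (1−β)Q₀ + βQ₁` satisfies
`D(P_β ‖ Q₀) ≤ β² · χ₂(Q₁‖Q₀)`. -/
theorem stmt_8 {Z : Type*} [Fintype Z] [Nonempty Z] (Q₀ Q₁ : Z → ℝ)
    (hQ₀nonneg : ∀ z, 0 ≤ Q₀ z) (hQ₁nonneg : ∀ z, 0 ≤ Q₁ z)
    (hQ₀sum : ∑ z, Q₀ z = 1) (hQ₁sum : ∑ z, Q₁ z = 1)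
    (hac : ∀ z, Q₀ z = 0 → Q₁ z = 0)
    (β : ℝ) (hβ : β ∈ Set.Icc (0 : ℝ) 1) :
    (∑ z, ((1 - β) * Q₀ z + β * Q₁ z)
        * Real.log (((1 - β) * Q₀ z + β * Q₁ z) / Q₀ z))
      ≤ β ^ 2 * ∑ z ∈ Finset.univ.filter (fun z => 0 < Q₀ z),
          (Q₁ z - Q₀ z) ^ 2 / Q₀ z := by
  obtain ⟨hβ0, hβ1⟩ := hβ
  have hsupp : ∑ z ∈ Finset.univ.filter (fun z => 0 < Q₀ z), (Q₁ z - Q₀ z) ^ 2 / Q₀ z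
      = ∑ z, (Q₁ z - Q₀ z) ^ 2 / Q₀ z := by
    refine Finset.sum_filter_of_ne fun z _ hz => (hQ₀nonneg z).lt_of_ne' fun h => hz ?_
    simp [h]
  rw [hsupp]
  calc _ ≤ ∑ z, (β * (Q₁ z - Q₀ z) + β ^ 2 * ((Q₁ z - Q₀ z) ^ 2 / Q₀ z)) := by
        refine Finset.sum_le_sum fun z _ => ?_
        have hp : 0 ≤ (1 - β) * Q₀ z + β * Q₁ z :=
          add_nonneg (mul_nonneg (sub_nonneg.2 hβ1) (hQ₀nonneg z)) (mul_nonneg hβ0 (hQ₁nonneg z))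
        refine (mul_log_div_le_sub_add_sq_div hp (hQ₀nonneg z)
          fun h => by simp [h, hac z h]).trans_eq ?_
        ring
    _ = _ := by
        rw [Finset.sum_add_distrib, ← Finset.mul_sum, ← Finset.mul_sum, Finset.sum_sub_distrib,
          hQ₀sum, hQ₁sum]
        ring
end

section
/- Let (Ω, 𝔽, P) be a probability space with a filtration (𝔽_t)_{t∈ℕ}, let Γ be an ℕ-valued random variable, let α ∈ (0,1), and for each t ∈ ℕ let p_t be a version of the conditional probability P(Γ < t | 𝔽_t) with p_t 𝔽_t-measurable. Define τ = inf{ t ≥ 1 : p_t ≥ 1 − α }, and assume τ < ∞ almost surely. Then P(τ < Γ) ≤ α. -/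
open MeasureTheory

/-- If the conditional probability of `A` given `m'` is at least `c` on an `m'`-measurable set `D`,
then `c * μ D ≤ μ (D ∩ A)`. -/
theorem mul_measureReal_le_measureReal_inter_of_le_condExp {Ω : Type*} {m' m : MeasurableSpace Ω}
    {μ : Measure Ω} [IsFiniteMeasure μ] (hm : m' ≤ m) {A D : Set Ω} (hA : MeasurableSet A)
    (hD : MeasurableSet[m'] D) {q : Ω → ℝ}
    (hq : q =ᵐ[μ] μ[A.indicator (fun _ => (1 : ℝ)) | m']) {c : ℝ} (hc : ∀ ω ∈ D, c ≤ q ω) :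
    c * μ.real D ≤ μ.real (D ∩ A) := by
  have hq_int : Integrable q μ := integrable_condExp.congr hq.symm
  calc c * μ.real D ≤ ∫ ω in D, q ω ∂μ :=
        setIntegral_ge_of_const_le_real (hm D hD) (measure_ne_top μ D) hc hq_int.integrableOn
    _ = ∫ ω in D, (μ[A.indicator (fun _ => (1 : ℝ)) | m']) ω ∂μ :=
        integral_congr_ae (ae_restrict_of_ae hq)
    _ = ∫ ω in D, A.indicator (fun _ => (1 : ℝ)) ω ∂μ :=
        setIntegral_condExp hm ((integrable_const _).indicator hA) hD
    _ = μ.real (D ∩ A) := by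
        rw [setIntegral_indicator hA]
        simp

/-- **Probability-of-false-alarm guarantee of the Shiryaev-type stopping rule.**
If `p_t` is an `𝔽_t`-measurable version of `P(Γ < t | 𝔽_t)` and
`τ = inf{t ≥ 1 : p_t ≥ 1 − α}` is almost surely finite, then `P(τ < Γ) ≤ α`. -/
theorem stmt_16 {Ω : Type*} [m : MeasurableSpace Ω] (P : Measure Ω)
    [IsProbabilityMeasure P] (ℱ : Filtration ℕ m)
    (Γ : Ω → ℕ) (hΓ : Measurable Γ)
    (α : ℝ) (hα : α ∈ Set.Ioo (0 : ℝ) 1)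
    (p : ℕ → Ω → ℝ)
    (hpmeas : ∀ t, StronglyMeasurable[ℱ t] (p t))
    (hp : ∀ t, p t =ᵐ[P] P[({ω | Γ ω < t}).indicator (fun _ => (1 : ℝ)) | ℱ t])
    (τ : Ω → ℕ)
    (hτ : ∀ ω, τ ω = sInf {t : ℕ | 1 ≤ t ∧ 1 - α ≤ p t ω})
    (hfin : ∀ᵐ ω ∂P, ∃ t : ℕ, 1 ≤ t ∧ 1 - α ≤ p t ω) :
    (P {ω | τ ω < Γ ω}).toReal ≤ α := by
  let D : ℕ → Set Ω := fun t =>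
    {ω | (1 ≤ t ∧ 1 - α ≤ p t ω) ∧ ∀ s < t, ¬ (1 ≤ s ∧ 1 - α ≤ p s ω)}
  have hlevel (s t : ℕ) (hst : s ≤ t) : MeasurableSet[ℱ t] {ω | 1 ≤ s ∧ 1 - α ≤ p s ω} :=
    ℱ.mono hst _ ((MeasurableSet.const _).inter ((hpmeas s).measurable measurableSet_Ici))
  have hD (t : ℕ) : MeasurableSet[ℱ t] (D t) := by
    have hD_eq : D t = {ω | 1 ≤ t ∧ 1 - α ≤ p t ω} ∩
        ⋂ s, ⋂ _ : s < t, {ω | 1 ≤ s ∧ 1 - α ≤ p s ω}ᶜ := by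
      ext ω
      simp [D]
    rw [hD_eq]
    exact (hlevel t t le_rfl).inter <| MeasurableSet.iInter fun s => MeasurableSet.iInter fun hs => (hlevel s t hs.le).compl
  have hτD {t : ℕ} {ω : Ω} (h : ω ∈ D t) : τ ω = t := by
    rw [hτ]
    exact (IsLeast.csInf_eq ⟨h.1, fun s hs => not_lt.1 fun hlt => h.2 s hlt hs⟩)
  have hdisj : Pairwise (Function.onFun Disjoint D) := fun s t hst =>
    Set.disjoint_left.2 fun ω hs ht => hst ((hτD hs).symm.trans (hτD ht))
  have hA (t : ℕ) : MeasurableSet {ω | Γ ω < t} := hΓ measurableSet_Iio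
  have hDA (t : ℕ) : MeasurableSet (D t ∩ {ω | Γ ω < t}) := (ℱ.le t _ (hD t)).inter (hA t)
  have hcover : P (⋃ t, D t) = 1 := by
    rw [prob_compl_eq_zero_iff (MeasurableSet.iUnion fun t => ℱ.le t _ (hD t)) |>.symm]
    filter_upwards [hfin] with ω hω
    classical
    exact Set.mem_iUnion.2 ⟨Nat.find hω, Nat.find_spec hω, fun s hs => Nat.find_min hω hs⟩
  have hle (t : ℕ) : ENNReal.ofReal (1 - α) * P (D t) ≤ P (D t ∩ {ω | Γ ω < t}) := by
    have h := mul_measureReal_le_measureReal_inter_of_le_condExp (ℱ.le t) (hA t) (hD t) (hp t)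
      fun ω hω => hω.1.2
    rw [← ofReal_measureReal, ← ofReal_measureReal,
      ← ENNReal.ofReal_mul (by linarith [hα.2])]
    exact ENNReal.ofReal_le_ofReal h
  have hU : ENNReal.ofReal (1 - α) ≤ P (⋃ t, D t ∩ {ω | Γ ω < t}) := by
    rw [measure_iUnion (fun s t hst => (hdisj hst).mono Set.inter_subset_left
      Set.inter_subset_left) hDA]
    calc ENNReal.ofReal (1 - α) = ENNReal.ofReal (1 - α) * P (⋃ t, D t) := by
          rw [hcover, mul_one]
      _ = ∑' t, ENNReal.ofReal (1 - α) * P (D t) := by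
          rw [measure_iUnion hdisj fun t => ℱ.le t _ (hD t), ENNReal.tsum_mul_left]
      _ ≤ _ := ENNReal.tsum_le_tsum hle
  have hsub : {ω | τ ω < Γ ω} ⊆ (⋃ t, D t ∩ {ω | Γ ω < t})ᶜ := by
    intro ω hω hmem
    obtain ⟨t, ht, hlt⟩ := Set.mem_iUnion.1 hmem
    rw [Set.mem_ofPred_eq, hτD ht] at hω
    exact lt_asymm hω hlt
  calc (P {ω | τ ω < Γ ω}).toReal ≤ P.real (⋃ t, D t ∩ {ω | Γ ω < t})ᶜ := measureReal_mono hsub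
    _ = 1 - P.real (⋃ t, D t ∩ {ω | Γ ω < t}) :=
        probReal_compl_eq_one_sub (MeasurableSet.iUnion hDA)
    _ ≤ α := by
        have := (ENNReal.ofReal_le_iff_le_toReal (measure_ne_top P _)).1 hU
        rw [measureReal_def]
        linarith
end
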